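/- arXiv:2411.16163 — 2 statements merged into one kernel-verified Lean document; each statement's English description precedes it below -/
import Mathlib

section
/- Let ε ∈ (0,1), γ ∈ (0,1], Δ > 0 satisfy γ²ε ≤ 1/2 and Δ/ε ≥ ln(γ^{−2}ε^{−1}) > 0, and set β := ln(γ^{−2}ε^{−1})/Δ. Let N ≥ 1, let p_0,…,p_{N−1} ≥ 0 with Σ_j p_j = 1 and p_0 ≥ γ², and let E_0,…,E_{N−1} be reals with E_j ≥ E_0 + Δ for all j ≠ 0. Define R(x) := Σ_{j} p_j ( e^{β(x−E_j)} − e^{2β(x−E_j)} ). Then for every x ∈ [E_0 − ε/2, E_0], one has R(x) < (1/2)·p_0·β·ε + p_0·ε. -/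
open Real

/-- If `b * s ≤ 0`, then `e^{bs} - e^{2bs} ≤ -bs`. -/
theorem exp_sub_exp_two_mul_le_neg (b s : ℝ) (h : b * s ≤ 0) :
    Real.exp (b * s) - Real.exp (2 * b * s) ≤ -(b * s) := by
  have hsq : Real.exp (2 * b * s) = Real.exp (b * s) * Real.exp (b * s) := by
    rw [← Real.exp_add]; ring_nf
  have h1 : Real.exp (b * s) ≤ 1 := Real.exp_le_one_iff.mpr h
  rw [hsq]
  nlinarith [Real.add_one_le_exp (b * s), sq_nonneg (1 - Real.exp (b * s))]

/-- Bound on the residue function `R(x) = ∑_j p_j (e^{β(x−E_j)} − e^{2β(x−E_j)})`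
for `x` in the interval `[E_0 − ε/2, E_0]`, with `β = ln(γ⁻²ε⁻¹)/Δ`. -/
theorem residue_upper_bound_near_ground_energy
    (ε γ Δ : ℝ) (hε0 : 0 < ε) (hε1 : ε < 1) (hγ0 : 0 < γ) (hγ1 : γ ≤ 1)
    (hΔ : 0 < Δ)
    (hsmall : γ ^ 2 * ε ≤ 1 / 2)
    (hlogpos : 0 < Real.log ((γ ^ 2 * ε)⁻¹))
    (hgap : Δ / ε ≥ Real.log ((γ ^ 2 * ε)⁻¹))
    (N : ℕ) (hN : 0 < N)
    (p E : Fin N → ℝ)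
    (hp0 : ∀ j, 0 ≤ p j) (hpsum : ∑ j, p j = 1)
    (hoverlap : γ ^ 2 ≤ p ⟨0, hN⟩)
    (hgapE : ∀ j : Fin N, j ≠ ⟨0, hN⟩ → E ⟨0, hN⟩ + Δ ≤ E j)
    (x : ℝ) (hx1 : E ⟨0, hN⟩ - ε / 2 ≤ x) (hx2 : x ≤ E ⟨0, hN⟩) :
    ∑ j, p j * (Real.exp ((Real.log ((γ ^ 2 * ε)⁻¹) / Δ) * (x - E j))
        - Real.exp (2 * (Real.log ((γ ^ 2 * ε)⁻¹) / Δ) * (x - E j)))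
      < 1 / 2 * p ⟨0, hN⟩ * (Real.log ((γ ^ 2 * ε)⁻¹) / Δ) * ε + p ⟨0, hN⟩ * ε := by
  have hc : 0 < γ ^ 2 * ε := by positivity
  set c := γ ^ 2 * ε with hcdef
  set β := Real.log c⁻¹ / Δ with hβ
  have hβ0 : 0 < β := div_pos hlogpos hΔ
  set i : Fin N := ⟨0, hN⟩ with hi
  have hexp : Real.exp (-(β * Δ)) = c := by
    rw [hβ, div_mul_cancel₀ _ hΔ.ne', Real.log_inv, neg_neg, Real.exp_log hc]
  have hpi : 0 < p i := lt_of_lt_of_le (by positivity) hoverlap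
  have hground : p i * (Real.exp (β * (x - E i)) - Real.exp (2 * β * (x - E i)))
      ≤ p i * (β * (ε / 2)) := by
    refine mul_le_mul_of_nonneg_left ?_ hpi.le
    refine (exp_sub_exp_two_mul_le_neg β (x - E i)
      (mul_nonpos_of_nonneg_of_nonpos hβ0.le (by linarith))).trans ?_
    rw [← mul_neg]
    exact mul_le_mul_of_nonneg_left (by linarith) hβ0.le
  have hexcited : ∀ j ∈ Finset.univ.erase i,
      p j * (Real.exp (β * (x - E j)) - Real.exp (2 * β * (x - E j))) ≤ p j * c := by
    intro j hj
    refine mul_le_mul_of_nonneg_left ?_ (hp0 j)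
    have hE := hgapE j (Finset.ne_of_mem_erase hj)
    have hle : Real.exp (β * (x - E j)) ≤ c := by
      rw [← hexp, ← mul_neg]
      exact Real.exp_le_exp.mpr (mul_le_mul_of_nonneg_left (by linarith) hβ0.le)
    linarith [Real.exp_pos (2 * β * (x - E j))]
  have hsum := Finset.sum_le_sum hexcited
  rw [← Finset.sum_mul] at hsum
  rw [← Finset.add_sum_erase _ _ (Finset.mem_univ i)] at hpsum ⊢
  have hrest : (∑ j ∈ Finset.univ.erase i, p j) * c < p i * ε :=
    calc (∑ j ∈ Finset.univ.erase i, p j) * c < 1 * c :=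
          mul_lt_mul_of_pos_right (by linarith) hc
      _ ≤ p i * ε := by
          rw [one_mul]
          exact mul_le_mul_of_nonneg_right hoverlap hε0.le
  linarith
end

section
/- Let N ≥ 1, let p_0,…,p_{N−1} ≥ 0 with Σ_j p_j = 1 and p_0 ≥ 1/2, let Δ > 0, and let E_0,…,E_{N−1} be reals with E_j ≥ E_0 + Δ for all j ≠ 0. Then for every complex number β with Re(β) > 0, the partition function D_β := Σ_{j=0}^{N−1} p_j · exp(−β E_j) is nonzero. -/
/-- Zero-free region of the partition function: if the ground-state weight satisfies
`p₀ ≥ 1/2` and all other energies exceed `E₀` by at least `Δ > 0`, then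
`D_β = ∑ j, p_j e^{−β E_j}` is nonzero for every complex `β` with `Re β > 0`. -/
theorem partition_function_zero_free
    (N : ℕ) (hN : 0 < N) (p E : Fin N → ℝ)
    (hp : ∀ j, 0 ≤ p j) (hpsum : ∑ j, p j = 1)
    (hp0 : 1 / 2 ≤ p ⟨0, hN⟩)
    (Δ : ℝ) (hΔ : 0 < Δ)
    (hgap : ∀ j : Fin N, j ≠ ⟨0, hN⟩ → E ⟨0, hN⟩ + Δ ≤ E j)
    (β : ℂ) (hβ : 0 < β.re) :
    ∑ j, (p j : ℂ) * Complex.exp (-β * (E j : ℂ)) ≠ 0 := by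
  set i : Fin N := ⟨0, hN⟩
  intro h
  rw [← Finset.add_sum_erase _ _ (Finset.mem_univ i)] at h hpsum
  have norm_term (j : Fin N) :
      ‖(p j : ℂ) * Complex.exp (-β * (E j : ℂ))‖ = p j * Real.exp (-β.re * E j) := by
    rw [norm_mul, Complex.norm_of_nonneg (hp j), Complex.norm_exp]
    simp
  have ground_le : p i * Real.exp (-β.re * E i) ≤
      (1 - p i) * Real.exp (-β.re * (E i + Δ)) := by
    rw [← norm_term, eq_neg_of_add_eq_zero_left h, norm_neg, ← hpsum, add_sub_cancel_left,
      Finset.sum_mul]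
    refine (norm_sum_le _ _).trans (Finset.sum_le_sum fun j hj => ?_)
    rw [norm_term]
    refine mul_le_mul_of_nonneg_left (Real.exp_le_exp.2 ?_) (hp j)
    exact mul_le_mul_of_nonpos_left (hgap j (Finset.ne_of_mem_erase hj)) (by linarith)
  have exp_lt : Real.exp (-β.re * (E i + Δ)) < Real.exp (-β.re * E i) :=
    Real.exp_lt_exp.2 (by nlinarith [mul_pos hβ hΔ])
  have excited_le : (1 - p i) * Real.exp (-β.re * (E i + Δ)) ≤
      p i * Real.exp (-β.re * (E i + Δ)) :=
    mul_le_mul_of_nonneg_right (by linarith) (Real.exp_pos _).le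
  have lt_ground := mul_lt_mul_of_pos_left exp_lt (show 0 < p i by linarith)
  linarith
end
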